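/- arXiv:1305.1893 — 3 statements merged into one kernel-verified Lean document; each statement's English description precedes it below -/
import Mathlib

section
/- For every natural number D ≥ 1 and every natural number d with 1 ≤ d ≤ D, substituting F = D + 1 in the twice-expanding bin proportion gives Benford's law: (Real.log(1 + 1/d) + Real.log((1 + D + d·(D+1))/(1 + D + (d−1)·(D+1))) + Real.log((1 + D + D·(D+1) + d·(D+1)²)/(1 + D + D·(D+1) + (d−1)·(D+1)²))) / Real.log(1 + D + D·(D+1) + D·(D+1)²) = Real.log(1 + 1/d) / Real.log(D + 1). -/
/-- Substituting `F = D + 1` in the twice-expanding bin proportion gives Benford's law. -/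
theorem stmt_4 (D : ℕ) (hD : 1 ≤ D) (d : ℕ) (hd1 : 1 ≤ d) (hdD : d ≤ D) :
    (Real.log (1 + 1 / (d : ℝ)) +
        Real.log ((1 + (D : ℝ) + (d : ℝ) * ((D : ℝ) + 1)) /
          (1 + (D : ℝ) + ((d : ℝ) - 1) * ((D : ℝ) + 1))) +
        Real.log ((1 + (D : ℝ) + (D : ℝ) * ((D : ℝ) + 1) + (d : ℝ) * ((D : ℝ) + 1) ^ 2) /
          (1 + (D : ℝ) + (D : ℝ) * ((D : ℝ) + 1) + ((d : ℝ) - 1) * ((D : ℝ) + 1) ^ 2))) /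
      Real.log (1 + (D : ℝ) + (D : ℝ) * ((D : ℝ) + 1) + (D : ℝ) * ((D : ℝ) + 1) ^ 2) =
    Real.log (1 + 1 / (d : ℝ)) / Real.log ((D : ℝ) + 1) := by
  have hd : (0 : ℝ) < d := by exact_mod_cast hd1
  have hD0 : (0 : ℝ) < (D : ℝ) := by exact_mod_cast hD
  have hF : (D : ℝ) + 1 ≠ 0 := by positivity
  have e1 : (1 + (D : ℝ) + (d : ℝ) * ((D : ℝ) + 1)) /
      (1 + (D : ℝ) + ((d : ℝ) - 1) * ((D : ℝ) + 1)) = 1 + 1 / (d : ℝ) := by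
    rw [show 1 + (D : ℝ) + ((d : ℝ) - 1) * ((D : ℝ) + 1) = d * ((D : ℝ) + 1) by ring]
    field_simp
    ring
  have e2 : (1 + (D : ℝ) + (D : ℝ) * ((D : ℝ) + 1) + (d : ℝ) * ((D : ℝ) + 1) ^ 2) /
      (1 + (D : ℝ) + (D : ℝ) * ((D : ℝ) + 1) + ((d : ℝ) - 1) * ((D : ℝ) + 1) ^ 2)
      = 1 + 1 / (d : ℝ) := by
    rw [show 1 + (D : ℝ) + (D : ℝ) * ((D : ℝ) + 1) + ((d : ℝ) - 1) * ((D : ℝ) + 1) ^ 2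
      = d * ((D : ℝ) + 1) ^ 2 by ring]
    field_simp
    ring
  have e3 : 1 + (D : ℝ) + (D : ℝ) * ((D : ℝ) + 1) + (D : ℝ) * ((D : ℝ) + 1) ^ 2
      = ((D : ℝ) + 1) ^ 3 := by ring
  have hL : Real.log ((D : ℝ) + 1) ≠ 0 := (Real.log_pos (by linarith)).ne'
  rw [e1, e2, e3, Real.log_pow]
  push_cast
  field_simp
  ring
end

section
/- Let D ≥ 1 be a natural number and let d be a natural number with 1 ≤ d ≤ D. Then the General Law of Relative Quantities extends continuously to F = 1 with value 1/D: the function F ↦ Real.log((D + d·(F − 1))/(D + (d − 1)·(F − 1))) / Real.log(F) tends to 1/D as F tends to 1 within the reals distinct from 1. -/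
/-- The General Law of Relative Quantities extends continuously to `F = 1` with
value `1/D`. -/
theorem stmt_13 (D : ℕ) (hD : 1 ≤ D) (d : ℕ) (hd1 : 1 ≤ d) (hdD : d ≤ D) :
    Filter.Tendsto (fun F : ℝ =>
        Real.log (((D : ℝ) + (d : ℝ) * (F - 1)) / ((D : ℝ) + ((d : ℝ) - 1) * (F - 1))) /
          Real.log F)
      (nhdsWithin 1 {(1 : ℝ)}ᶜ) (nhds (1 / (D : ℝ))) := by
  have hD0 : (D : ℝ) ≠ 0 := by
    have : D ≠ 0 := by omega
    exact_mod_cast this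
  have lin : ∀ c : ℝ, HasDerivAt (fun F : ℝ => (D : ℝ) + c * (F - 1)) c 1 := by
    intro c
    simpa using (((hasDerivAt_id (1 : ℝ)).sub_const 1).const_mul c).const_add (D : ℝ)
  have hf : HasDerivAt (fun F : ℝ =>
      Real.log (((D : ℝ) + (d : ℝ) * (F - 1)) / ((D : ℝ) + ((d : ℝ) - 1) * (F - 1))))
      (1 / (D : ℝ)) 1 := by
    have h := ((lin d).fun_div (lin ((d : ℝ) - 1)) (by simpa using hD0)).log
      (by simpa using hD0)
    convert h using 1
    simp only [sub_self, mul_zero, add_zero]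
    field_simp
    ring
  have hg : HasDerivAt Real.log 1 1 := by
    simpa using Real.hasDerivAt_log (one_ne_zero : (1 : ℝ) ≠ 0)
  have h := (hasDerivAt_iff_tendsto_slope.1 hf).div (hasDerivAt_iff_tendsto_slope.1 hg)
    one_ne_zero
  rw [div_one] at h
  refine h.congr' ?_
  filter_upwards [self_mem_nhdsWithin] with F hF
  have hF' : F - 1 ≠ 0 := sub_ne_zero.2 hF
  simp only [Pi.div_apply, slope_def_field, sub_self, mul_zero, add_zero, div_self hD0,
    Real.log_one, sub_zero]
  exact div_div_div_cancel_right₀ hF' _ _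
end

section
/- Let a, b, k, K be real numbers with 0 < a < b, k > 0, and K > 0. Let μ be the measure on ℝ given by Lebesgue measure with density x ↦ ENNReal.ofReal(Set.indicator (Set.Ioo a b) (fun x => k/x) x). Then the pushforward of μ under the map x ↦ K·x equals Lebesgue measure with density x ↦ ENNReal.ofReal(Set.indicator (Set.Ioo (K·a) (K·b)) (fun x => k/x) x); that is, multiplying a k/x-distributed quantity by a positive constant K yields again a k/x-type density, now supported on (K·a, K·b). -/
open MeasureTheory

/-- Scale invariance of the k/x distribution: the pushforward under `x ↦ K·x` of
the measure with density `k/x` on `(a, b)` is the measure with density `k/x`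
on `(K·a, K·b)`. -/
theorem stmt_15 (a b k K : ℝ) (ha : 0 < a) (hab : a < b) (hk : 0 < k) (hK : 0 < K) :
    Measure.map (fun x : ℝ => K * x)
      (volume.withDensity
        (fun x => ENNReal.ofReal (Set.indicator (Set.Ioo a b) (fun x => k / x) x))) =
    volume.withDensity
      (fun x => ENNReal.ofReal (Set.indicator (Set.Ioo (K * a) (K * b)) (fun x => k / x) x)) := by
  have hm : Measurable (fun x : ℝ => K * x) := measurable_const_mul K
  have hd : ∀ c d : ℝ, Measurable
      (fun x => ENNReal.ofReal (Set.indicator (Set.Ioo c d) (fun x => k / x) x)) := fun c d =>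
    ((measurable_const.div measurable_id).indicator measurableSet_Ioo).ennreal_ofReal
  ext s hs
  rw [Measure.map_apply hm hs, withDensity_apply _ (hm hs), withDensity_apply _ hs]
  conv_rhs => rw [← Real.smul_map_volume_mul_left hK.ne']
  rw [Measure.restrict_smul, lintegral_smul_measure, setLIntegral_map hs (hd _ _) hm,
    smul_eq_mul, ← lintegral_const_mul' _ _ ENNReal.ofReal_ne_top]
  refine lintegral_congr fun x => ?_
  rw [← ENNReal.ofReal_mul (abs_nonneg K), abs_of_pos hK]
  congr 1
  by_cases hx : x ∈ Set.Ioo a b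
  · have hx' : K * x ∈ Set.Ioo (K * a) (K * b) :=
      ⟨mul_lt_mul_of_pos_left hx.1 hK, mul_lt_mul_of_pos_left hx.2 hK⟩
    have hx0 : x ≠ 0 := (ha.trans hx.1).ne'
    rw [Set.indicator_of_mem hx, Set.indicator_of_mem hx']
    field_simp
  · have hx' : K * x ∉ Set.Ioo (K * a) (K * b) := fun h =>
      hx ⟨lt_of_mul_lt_mul_left h.1 hK.le, lt_of_mul_lt_mul_left h.2 hK.le⟩
    rw [Set.indicator_of_notMem hx, Set.indicator_of_notMem hx', mul_zero]
end
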